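/- arXiv:1201.5648 — 2 statements merged into one kernel-verified Lean document; each statement's English description precedes it below -/
import Mathlib

section
/- Let d ≥ 1, η > 0, t ∈ (0, d], τ = t/d, and let ω_d denote the Lebesgue measure of the Euclidean unit ball of ℝ^d. Let a : {1, 2, 3, ...} → [0,∞) be a non-increasing square-summable sequence. Then the following are equivalent: (i) there exists M₁ ≥ 0 such that a_n ≤ M₁ n^{(τ−1)/2} exp(−η ω_d^{−τ} n^τ) for all n ≥ 1; (ii) there exists M₂ ≥ 0 such that (Σ_{n>N} a_n²)^{1/2} ≤ M₂ exp(−η ω_d^{−τ} N^τ) for all N ≥ 0. Moreover the best constants are comparable: M₂ ≤ C M₁ and M₁ ≤ C M₂ with a constant C depending only on η, t and d. -/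
open scoped BigOperators
noncomputable section

/-- The Lebesgue measure `ω_d` of the Euclidean unit ball of `ℝ^d`. -/
def unitBallVol (d : ℕ) : ℝ :=
  (MeasureTheory.volume (Metric.ball (0 : EuclideanSpace ℝ (Fin d)) 1)).toReal

lemma unitBallVol_pos (d : ℕ) : 0 < unitBallVol d :=
  ENNReal.toReal_pos (Metric.measure_ball_pos _ _ one_pos).ne' MeasureTheory.measure_ball_lt_top.ne

/-- A discrete version of the formula for the derivative of `exp (-2c x ^ τ)`. -/
lemma rpow_mul_exp_le_sub {c τ : ℝ} (hc : 0 < c) (hτ : 0 < τ) (hτ1 : τ ≤ 1) (m : ℕ) :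
    ((m + 1 : ℕ) : ℝ) ^ (τ - 1) * Real.exp (-(2 * c) * ((m + 1 : ℕ) : ℝ) ^ τ) ≤
      (2 * c * τ)⁻¹ * (Real.exp (-(2 * c) * (m : ℝ) ^ τ) -
        Real.exp (-(2 * c) * ((m + 1 : ℕ) : ℝ) ^ τ)) := by
  set x : ℝ := ((m + 1 : ℕ) : ℝ) with hx
  have hmx : (m : ℝ) = x - 1 := by rw [hx]; push_cast; ring
  have hx1 : 1 ≤ x := by rw [hx]; exact_mod_cast Nat.le_add_left 1 m
  have hx0 : 0 < x := by linarith
  have bern : (1 + -(1 / x)) ^ τ ≤ 1 + τ * -(1 / x) :=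
    rpow_one_add_le_one_add_mul_self (by
      have : 1 / x ≤ 1 := by rw [div_le_one hx0]; exact hx1
      linarith) hτ.le hτ1
  have hpow : (m : ℝ) ^ τ = x ^ τ * (1 + -(1 / x)) ^ τ := by
    rw [← Real.mul_rpow hx0.le, hmx]
    · congr 1; field_simp; ring
    · have : 1 / x ≤ 1 := by rw [div_le_one hx0]; exact hx1
      linarith
  have hdiff : τ * x ^ (τ - 1) ≤ x ^ τ - (m : ℝ) ^ τ := by
    have h1 := mul_le_mul_of_nonneg_left bern (Real.rpow_nonneg hx0.le τ)
    rw [Real.rpow_sub_one hx0.ne', hpow]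
    have : x ^ τ * (1 + τ * -(1 / x)) = x ^ τ - τ * (x ^ τ / x) := by ring
    linarith
  have hexp : Real.exp (-(2 * c) * (m : ℝ) ^ τ) =
      Real.exp (-(2 * c) * x ^ τ) * Real.exp (2 * c * (x ^ τ - (m : ℝ) ^ τ)) := by
    rw [← Real.exp_add]; congr 1; ring
  have hadd := Real.add_one_le_exp (2 * c * (x ^ τ - (m : ℝ) ^ τ))
  have key : 2 * c * (τ * x ^ (τ - 1)) ≤ Real.exp (2 * c * (x ^ τ - (m : ℝ) ^ τ)) - 1 := by
    have := mul_le_mul_of_nonneg_left hdiff (by positivity : 0 ≤ 2 * c)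
    linarith
  rw [inv_mul_eq_div, le_div_iff₀ (by positivity), hexp]
  have := mul_le_mul_of_nonneg_left key (Real.exp_pos (-(2 * c) * x ^ τ)).le
  linarith

lemma tsum_ite_lt_le_of_le_sub {b F : ℕ → ℝ} (hb : ∀ n, 0 ≤ b n) (hF : ∀ n, 0 ≤ F n)
    (h : ∀ m, b (m + 1) ≤ F m - F (m + 1)) (N : ℕ) :
    ∑' n : ℕ, (if N < n then b n else 0) ≤ F N := by
  have hsum : ∀ m, ∑ i ∈ Finset.range (m + 1), (if N < i then b i else 0) ≤ F N - F (max N m) := by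
    intro m
    induction m with
    | zero => simp
    | succ m ih =>
      rw [Finset.sum_range_succ]
      by_cases hN : N < m + 1
      · rw [if_pos hN, max_eq_right hN.le]
        rw [max_eq_right (Nat.lt_succ_iff.mp hN)] at ih
        linarith [h m]
      · rw [if_neg hN, max_eq_left (not_lt.mp hN)]
        rw [max_eq_left (by omega)] at ih
        linarith
  have hnn : ∀ n, 0 ≤ (if N < n then b n else 0) := fun n => by split_ifs <;> simp [hb]
  refine Real.tsum_le_of_sum_range_le hnn fun m => ?_
  have h1 := Finset.sum_range_succ (fun i => if N < i then b i else 0) m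
  linarith [hsum m, hF (max N m), hnn m]

lemma sqrt_tail_le_of_le {c τ : ℝ} (hc : 0 < c) (hτ : 0 < τ) (hτ1 : τ ≤ 1) {a : ℕ → ℝ}
    (ha : ∀ n, 0 ≤ a n) {M : ℝ} (hM : 0 ≤ M)
    (h : ∀ n : ℕ, 1 ≤ n → a n ≤ M * (n : ℝ) ^ ((τ - 1) / 2) * Real.exp (-c * (n : ℝ) ^ τ))
    (N : ℕ) :
    Real.sqrt (∑' n : ℕ, if N < n then a n ^ 2 else 0) ≤
      Real.sqrt (2 * c * τ)⁻¹ * M * Real.exp (-c * (N : ℝ) ^ τ) := by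
  apply Real.sqrt_le_iff.mpr ⟨by positivity, ?_⟩
  have hsq (y : ℝ) : Real.exp (-c * y) ^ 2 = Real.exp (-(2 * c) * y) := by
    rw [← Real.exp_nat_mul]; congr 1; push_cast; ring
  rw [mul_pow, mul_pow, Real.sq_sqrt (by positivity), hsq]
  refine tsum_ite_lt_le_of_le_sub (b := fun n => a n ^ 2)
    (F := fun n => (2 * c * τ)⁻¹ * M ^ 2 * Real.exp (-(2 * c) * (n : ℝ) ^ τ))
    (fun n => sq_nonneg _) (fun n => by positivity) (fun m => ?_) N
  have h1 := pow_le_pow_left₀ (ha (m + 1)) (h (m + 1) (by omega)) 2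
  rw [mul_pow, mul_pow, hsq, ← Real.rpow_mul_natCast (by positivity)] at h1
  have h2 := mul_le_mul_of_nonneg_left (rpow_mul_exp_le_sub hc hτ hτ1 m) (sq_nonneg M)
  have h3 : (τ - 1) / 2 * ((2 : ℕ) : ℝ) = τ - 1 := by push_cast; ring
  rw [h3] at h1
  linarith

/-- Stepping back from `n` by `k ≈ n ^ (1 - τ)` changes `n ^ τ` only by a bounded amount. -/
lemma exists_step_back {τ : ℝ} (hτ : 0 < τ) (hτ1 : τ ≤ 1) {n : ℕ} (hn : 1 ≤ n) :
    ∃ k : ℕ, k ≤ n ∧ (n : ℝ) ^ (1 - τ) ≤ k ∧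
      (n : ℝ) ^ τ ≤ ((n - k : ℕ) : ℝ) ^ τ + 2 := by
  have hn1 : (1 : ℝ) ≤ n := by exact_mod_cast hn
  have hn0 : (0 : ℝ) < n := by linarith
  have hkn : ⌈(n : ℝ) ^ (1 - τ)⌉₊ ≤ n := by
    rw [Nat.ceil_le]
    calc (n : ℝ) ^ (1 - τ) ≤ (n : ℝ) ^ (1 : ℝ) :=
          Real.rpow_le_rpow_of_exponent_le hn1 (by linarith)
      _ = n := Real.rpow_one _
  refine ⟨_, hkn, Nat.le_ceil _, ?_⟩
  have hk := (Nat.ceil_lt_add_one (Real.rpow_nonneg hn0.le (1 - τ))).le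
  generalize ⌈(n : ℝ) ^ (1 - τ)⌉₊ = k at hkn hk
  have hq : ((n - k : ℕ) : ℝ) / n ≤ ((n - k : ℕ) : ℝ) ^ τ / (n : ℝ) ^ τ := by
    rw [← Real.div_rpow (by positivity) hn0.le]
    refine Real.self_le_rpow_of_le_one (by positivity) ?_ hτ1
    rw [div_le_one hn0]; exact_mod_cast Nat.sub_le n k
  have hnτ : 0 < (n : ℝ) ^ τ := Real.rpow_pos_of_pos hn0 τ
  have hprod : (n : ℝ) ^ (τ - 1) * (n : ℝ) ^ (1 - τ) = 1 := by
    rw [← Real.rpow_add hn0]; simp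
  have hle1 : (n : ℝ) ^ (τ - 1) ≤ 1 := Real.rpow_le_one_of_one_le_of_nonpos hn1 (by linarith)
  have hmul := mul_le_mul_of_nonneg_left hk (Real.rpow_nonneg hn0.le (τ - 1))
  have hq' := (le_div_iff₀ hnτ).mp hq
  have hcast : ((n - k : ℕ) : ℝ) / n * (n : ℝ) ^ τ = (n : ℝ) ^ τ - (n : ℝ) ^ (τ - 1) * k := by
    rw [Nat.cast_sub hkn, Real.rpow_sub_one hn0.ne']; field_simp
  linarith

lemma mul_sq_le_tail {a : ℕ → ℝ} (ha : ∀ n, 0 ≤ a n)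
    (hmono : ∀ m n : ℕ, 1 ≤ m → m ≤ n → a n ≤ a m) (hs : Summable fun n => a n ^ 2)
    {k n : ℕ} (hkn : k ≤ n) :
    (k : ℝ) * a n ^ 2 ≤ ∑' i : ℕ, if n - k < i then a i ^ 2 else 0 := by
  have hnn : ∀ i, 0 ≤ (if n - k < i then a i ^ 2 else 0) := fun i => by split_ifs <;> positivity
  have hs' : Summable fun i => if n - k < i then a i ^ 2 else 0 :=
    hs.of_nonneg_of_le hnn fun i => by split_ifs <;> first | exact le_rfl | positivity
  refine le_trans ?_ (hs'.sum_le_tsum (Finset.Ioc (n - k) n) fun i _ => hnn i)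
  have hcard : (Finset.Ioc (n - k) n).card = k := by rw [Nat.card_Ioc]; omega
  calc (k : ℝ) * a n ^ 2 = ∑ _i ∈ Finset.Ioc (n - k) n, a n ^ 2 := by
        rw [Finset.sum_const, hcard, nsmul_eq_mul]
    _ ≤ _ := Finset.sum_le_sum fun i hi => by
        obtain ⟨h1, h2⟩ := Finset.mem_Ioc.mp hi
        rw [if_pos h1]
        exact pow_le_pow_left₀ (ha n) (hmono i n (by omega) h2) 2

lemma le_of_sqrt_tail_le {c τ : ℝ} (hc : 0 < c) (hτ : 0 < τ) (hτ1 : τ ≤ 1) {a : ℕ → ℝ}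
    (ha : ∀ n, 0 ≤ a n) (hmono : ∀ m n : ℕ, 1 ≤ m → m ≤ n → a n ≤ a m)
    (hs : Summable fun n => a n ^ 2) {M : ℝ} (hM : 0 ≤ M)
    (h : ∀ N : ℕ, Real.sqrt (∑' n : ℕ, if N < n then a n ^ 2 else 0) ≤
      M * Real.exp (-c * (N : ℝ) ^ τ)) {n : ℕ} (hn : 1 ≤ n) :
    a n ≤ Real.exp (2 * c) * M * (n : ℝ) ^ ((τ - 1) / 2) * Real.exp (-c * (n : ℝ) ^ τ) := by
  obtain ⟨k, hkn, hk, hstep⟩ := exists_step_back hτ hτ1 hn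
  have hn0 : (0 : ℝ) < n := by exact_mod_cast hn
  have hroot : (n : ℝ) ^ ((1 - τ) / 2) * a n ≤
      Real.sqrt (∑' i : ℕ, if n - k < i then a i ^ 2 else 0) := by
    apply Real.le_sqrt_of_sq_le
    rw [mul_pow, ← Real.rpow_mul_natCast hn0.le]
    have h3 : (1 - τ) / 2 * ((2 : ℕ) : ℝ) = 1 - τ := by push_cast; ring
    rw [h3]
    exact (mul_le_mul_of_nonneg_right hk (sq_nonneg _)).trans (mul_sq_le_tail ha hmono hs hkn)
  have hexp : Real.exp (-c * ((n - k : ℕ) : ℝ) ^ τ) ≤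
      Real.exp (2 * c) * Real.exp (-c * (n : ℝ) ^ τ) := by
    rw [← Real.exp_add, Real.exp_le_exp]
    linarith [mul_le_mul_of_nonneg_left hstep hc.le]
  have hall := (hroot.trans (h (n - k))).trans (mul_le_mul_of_nonneg_left hexp hM)
  have hone : (n : ℝ) ^ ((τ - 1) / 2) * (n : ℝ) ^ ((1 - τ) / 2) = 1 := by
    rw [← Real.rpow_add hn0, show (τ - 1) / 2 + (1 - τ) / 2 = 0 by ring, Real.rpow_zero]
  calc a n = (n : ℝ) ^ ((τ - 1) / 2) * ((n : ℝ) ^ ((1 - τ) / 2) * a n) := by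
        rw [← mul_assoc, hone, one_mul]
    _ ≤ (n : ℝ) ^ ((τ - 1) / 2) * (M * (Real.exp (2 * c) * Real.exp (-c * (n : ℝ) ^ τ))) :=
        mul_le_mul_of_nonneg_left hall (by positivity)
    _ = _ := by ring

/-- **Equivalence of exponential classes.** For a non-increasing square-summable sequence
`a : {1,2,...} → [0,∞)`, with `τ = t/d`, the pointwise decay
`a_n ≤ M₁ n^{(τ−1)/2} exp(−η ω_d^{−τ} n^τ)` (for all `n ≥ 1`) is equivalent to the tail decay
`(Σ_{n>N} a_n²)^{1/2} ≤ M₂ exp(−η ω_d^{−τ} N^τ)` (for all `N ≥ 0`), with best constants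
comparable up to a constant `C = C(η,t,d)`. -/
theorem exponential_class_equivalence
    (d : ℕ) (hd : 1 ≤ d) (η t : ℝ) (hη : 0 < η) (ht0 : 0 < t) (htd : t ≤ (d : ℝ)) :
    ∃ C > 0, ∀ a : ℕ → ℝ,
      (∀ n, 0 ≤ a n) →
      (∀ m n : ℕ, 1 ≤ m → m ≤ n → a n ≤ a m) →
      Summable (fun n => a n ^ 2) →
      ((∀ M₁ : ℝ, 0 ≤ M₁ →
          (∀ n : ℕ, 1 ≤ n →
            a n ≤ M₁ * (n : ℝ) ^ ((t/(d : ℝ) - 1)/2) *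
              Real.exp (-η * unitBallVol d ^ (-(t/(d : ℝ))) * (n : ℝ) ^ (t/(d : ℝ)))) →
          ∀ N : ℕ,
            Real.sqrt (∑' n : ℕ, if N < n then a n ^ 2 else 0) ≤
              C * M₁ * Real.exp (-η * unitBallVol d ^ (-(t/(d : ℝ))) * (N : ℝ) ^ (t/(d : ℝ)))) ∧
       (∀ M₂ : ℝ, 0 ≤ M₂ →
          (∀ N : ℕ,
            Real.sqrt (∑' n : ℕ, if N < n then a n ^ 2 else 0) ≤
              M₂ * Real.exp (-η * unitBallVol d ^ (-(t/(d : ℝ))) * (N : ℝ) ^ (t/(d : ℝ)))) →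
          ∀ n : ℕ, 1 ≤ n →
            a n ≤ C * M₂ * (n : ℝ) ^ ((t/(d : ℝ) - 1)/2) *
              Real.exp (-η * unitBallVol d ^ (-(t/(d : ℝ))) * (n : ℝ) ^ (t/(d : ℝ))))) := by
  have hd0 : (0 : ℝ) < d := by exact_mod_cast hd
  have hτ : 0 < t / (d : ℝ) := div_pos ht0 hd0
  have hτ1 : t / (d : ℝ) ≤ 1 := (div_le_one hd0).mpr htd
  have hc : 0 < η * unitBallVol d ^ (-(t / (d : ℝ))) :=
    mul_pos hη (Real.rpow_pos_of_pos (unitBallVol_pos d) _)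
  simp only [neg_mul η]
  generalize η * unitBallVol d ^ (-(t / (d : ℝ))) = c at hc
  generalize t / (d : ℝ) = τ at hτ hτ1
  refine ⟨Real.sqrt (2 * c * τ)⁻¹ + Real.exp (2 * c), by positivity, fun a ha hmono hs =>
    ⟨fun M hM h N => (sqrt_tail_le_of_le hc hτ hτ1 ha hM h N).trans ?_,
      fun M hM h n hn => (le_of_sqrt_tail_le hc hτ hτ1 ha hmono hs hM h hn).trans ?_⟩⟩
  · gcongr
    exact le_add_of_nonneg_right (Real.exp_pos _).le
  · gcongr
    exact le_add_of_nonneg_left (Real.sqrt_nonneg _)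
end
end

section
/- Let H be a complex (or real) Hilbert space, let P : H → H be an orthogonal projection, let 0 < γ < θ < 1, and let r, r̃ ∈ H satisfy ‖r − r̃‖ ≤ γ ‖r̃‖ and ‖P r̃‖ ≥ θ ‖r̃‖. Then ‖P r‖ ≥ θ̃ ‖r‖, where θ̃ = (θ − γ)/(1 + γ) ∈ (0, θ). -/
noncomputable section

/-- **Feasible Dörfler marking.** Let `P` be an orthogonal projection on a Hilbert space `H`
(equivalently, an idempotent norm-contractive bounded operator), `0 < γ < θ < 1`, and let
`r, r̃ ∈ H` satisfy `‖r − r̃‖ ≤ γ‖r̃‖` and `‖P r̃‖ ≥ θ‖r̃‖`.  Then `‖P r‖ ≥ θ̃ ‖r‖` with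
`θ̃ = (θ − γ)/(1 + γ) ∈ (0, θ)`. -/
theorem feasible_doerfler
    (H : Type*) [NormedAddCommGroup H] [InnerProductSpace ℂ H] [CompleteSpace H]
    (P : H →L[ℂ] H)
    (hidem : ∀ x : H, P (P x) = P x)
    (hcontr : ∀ x : H, ‖P x‖ ≤ ‖x‖)
    (γ θ : ℝ) (hγ0 : 0 < γ) (hγθ : γ < θ) (hθ1 : θ < 1)
    (r rt : H) (hrt : ‖r - rt‖ ≤ γ * ‖rt‖) (hPrt : ‖P rt‖ ≥ θ * ‖rt‖) :
    0 < (θ - γ)/(1 + γ) ∧ (θ - γ)/(1 + γ) < θ ∧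
    ‖P r‖ ≥ (θ - γ)/(1 + γ) * ‖r‖ := by
  have hγ : 0 < 1 + γ := by linarith
  have hr : ‖r‖ ≤ (1 + γ) * ‖rt‖ := by
    linarith [norm_le_norm_add_norm_sub rt r, norm_sub_rev r rt]
  have hPr : (θ - γ) * ‖rt‖ ≤ ‖P r‖ := by
    have hdiff := hcontr (r - rt)
    rw [map_sub] at hdiff
    linarith [norm_le_norm_add_norm_sub (P r) (P rt)]
  refine ⟨div_pos (by linarith) hγ, ?_, ?_⟩
  · rw [div_lt_iff₀ hγ]
    nlinarith
  · calc (θ - γ) / (1 + γ) * ‖r‖ ≤ (θ - γ) / (1 + γ) * ((1 + γ) * ‖rt‖) :=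
          mul_le_mul_of_nonneg_left hr (div_nonneg (by linarith) hγ.le)
      _ = (θ - γ) * ‖rt‖ := by field_simp
      _ ≤ ‖P r‖ := hPr
end
end
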